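/- Let A be a real symmetric n × n matrix and let 0 ≤ k ≤ n. Then the k-th elementary symmetric function of the eigenvalues of A equals (1/k!) ∑ δ^{(j_1,…,j_k)}_{(i_1,…,i_k)} A_{i_1 j_1} ⋯ A_{i_k j_k}, where the sum runs over all index tuples i, j : Fin k → Fin n. -/

import Mathlib

/-- The generalized Kronecker symbol `δ^{(j_1,…,j_k)}_{(i_1,…,i_k)}`:
the determinant of the `k × k` real matrix whose `(a, b)` entry is `1`
if `i a = j b` and `0` otherwise. -/
noncomputable def gKron {n k : ℕ} (i j : Fin k → Fin n) : ℝ :=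
  Matrix.det (Matrix.of fun a b => if i a = j b then (1 : ℝ) else 0)

/-- The `k`-th elementary symmetric function of the (real) eigenvalues of a
real symmetric (Hermitian) `n × n` matrix `A`. -/
noncomputable def sigmaEig {n : ℕ} (A : Matrix (Fin n) (Fin n) ℝ)
    (hA : A.IsHermitian) (k : ℕ) : ℝ :=
  ∑ t ∈ Finset.univ.powersetCard k, ∏ a ∈ t, hA.eigenvalues a

lemma aux_sum_j {n k : ℕ} (A : Matrix (Fin n) (Fin n) ℝ) (i : Fin k → Fin n) :
    ∑ j : Fin k → Fin n, gKron i j * ∏ a : Fin k, A (i a) (j a) = (A.submatrix i i).det := by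
  rw [← Matrix.det_transpose, Matrix.det_apply']
  simp only [gKron, Matrix.det_apply', Finset.sum_mul]
  rw [Finset.sum_comm]
  refine Finset.sum_congr rfl fun σ _ => ?_
  rw [Finset.sum_eq_single (fun b => i (σ b))]
  · simp
  · intro j _ hj
    obtain ⟨b, hb⟩ := Function.ne_iff.mp hj
    have : ∏ b, (Matrix.of fun a b => if i a = j b then (1 : ℝ) else 0) (σ b) b = 0 :=
      Finset.prod_eq_zero (Finset.mem_univ b) (by simp [Ne.symm hb])
    rw [this]; simp
  · simp

lemma aux_card {n k : ℕ} (s : Finset (Fin n)) (hs : s.card = k) :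
    (Finset.univ.filter fun i : Fin k → Fin n =>
      Function.Injective i ∧ Finset.univ.image i = s).card = k.factorial := by
  have h1 : Fintype.card (Fin k ≃ s) = k.factorial := by
    rw [Fintype.card_equiv (Fintype.equivOfCardEq (by simp [hs]))]
    simp
  rw [← h1, ← Finset.card_univ]
  symm
  refine Finset.card_bij (fun e _ a => (e a : Fin n)) ?_ ?_ ?_
  · intro e _
    simp only [Finset.mem_filter, Finset.mem_univ, true_and]
    refine ⟨fun a b h => e.injective (Subtype.ext h), ?_⟩
    ext x
    simp only [Finset.mem_image, Finset.mem_univ, true_and]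
    constructor
    · rintro ⟨a, rfl⟩; exact (e a).2
    · intro hx; exact ⟨e.symm ⟨x, hx⟩, by simp⟩
  · intro e _ f _ h
    ext a
    exact congrArg Fin.val (congrFun h a)
  · intro i hi
    simp only [Finset.mem_filter, Finset.mem_univ, true_and] at hi
    obtain ⟨hi, rfl⟩ := hi
    refine ⟨Equiv.ofBijective (fun a => ⟨i a, by simp⟩) ⟨?_, ?_⟩, Finset.mem_univ _, ?_⟩
    · intro a b h; exact hi (congrArg Subtype.val h)
    · rintro ⟨x, hx⟩
      obtain ⟨a, _, rfl⟩ := Finset.mem_image.mp hx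
      exact ⟨a, rfl⟩
    · rfl

lemma aux_det {n k : ℕ} (A : Matrix (Fin n) (Fin n) ℝ) (i : Fin k → Fin n)
    (s : Finset (Fin n)) (hi : Function.Injective i) (hs : Finset.univ.image i = s) :
    (A.submatrix i i).det =
      (A.submatrix (Subtype.val : s → Fin n) (Subtype.val : s → Fin n)).det := by
  subst hs
  let e : Fin k ≃ (Finset.univ.image i : Finset (Fin n)) :=
    Equiv.ofBijective (fun a => ⟨i a, by simp⟩) ⟨fun a b h => hi (congrArg Subtype.val h), by
      rintro ⟨x, hx⟩
      obtain ⟨a, _, rfl⟩ := Finset.mem_image.mp hx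
      exact ⟨a, rfl⟩⟩
  rw [← Matrix.det_submatrix_equiv_self e]
  rfl

lemma aux_sum_i {n k : ℕ} (A : Matrix (Fin n) (Fin n) ℝ) :
    ∑ i : Fin k → Fin n, (A.submatrix i i).det =
      (k.factorial : ℝ) * ∑ s ∈ Finset.univ.powersetCard k,
        (A.submatrix (Subtype.val : s → Fin n) (Subtype.val : s → Fin n)).det := by
  have h0 : ∑ i : Fin k → Fin n, (A.submatrix i i).det =
      ∑ i ∈ Finset.univ.filter (fun i : Fin k → Fin n => Function.Injective i),
        (A.submatrix i i).det := by
    symm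
    refine Finset.sum_subset (Finset.filter_subset _ _) fun i _ hi => ?_
    simp only [Finset.mem_filter, Finset.mem_univ, true_and] at hi
    obtain ⟨a, b, hab, hne⟩ := Function.not_injective_iff.mp hi
    exact Matrix.det_zero_of_row_eq hne (by ext c; simp [hab])
  rw [h0, ← Finset.sum_fiberwise_of_maps_to (t := Finset.univ.powersetCard k)
    (g := fun i => Finset.univ.image i), Finset.mul_sum]
  · refine Finset.sum_congr rfl fun s hs => ?_
    rw [Finset.filter_filter, Finset.sum_congr rfl (g := fun _ =>
      (A.submatrix (Subtype.val : s → Fin n) (Subtype.val : s → Fin n)).det),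
      Finset.sum_const, aux_card s (Finset.mem_powersetCard.mp hs).2, nsmul_eq_mul]
    intro i hi
    simp only [Finset.mem_filter, Finset.mem_univ, true_and] at hi
    exact aux_det A i s hi.1 hi.2
  · intro i hi
    simp only [Finset.mem_filter, Finset.mem_univ, true_and] at hi
    simp [Finset.mem_powersetCard, Finset.card_image_of_injective _ hi]

lemma aux_sigma {n k : ℕ} (hk : k ≤ n) (A : Matrix (Fin n) (Fin n) ℝ) (hA : A.IsHermitian) :
    sigmaEig A hA k = ∑ s ∈ Finset.univ.powersetCard k,
        (A.submatrix (Subtype.val : s → Fin n) (Subtype.val : s → Fin n)).det := by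
  have hc : A.charpoly = (Matrix.diagonal hA.eigenvalues).charpoly := by
    rw [hA.charpoly_eq, Matrix.charpoly_diagonal]; rfl
  have h1 := A.charpoly_coeff_eq_sum_minors k (by simpa using hk)
  have h2 := (Matrix.diagonal hA.eigenvalues).charpoly_coeff_eq_sum_minors k (by simpa using hk)
  rw [← hc, h1] at h2
  have h3 := mul_left_cancel₀ (pow_ne_zero k (by norm_num : (-1 : ℝ) ≠ 0)) h2
  rw [h3, sigmaEig]
  refine Finset.sum_congr rfl fun s _ => ?_
  rw [Matrix.submatrix_diagonal _ _ Subtype.val_injective, Matrix.det_diagonal]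
  exact (Finset.prod_coe_sort s hA.eigenvalues).symm

/-- `σ_k(A) = (1/k!) ∑ δ^{(j_1,…,j_k)}_{(i_1,…,i_k)} A_{i_1 j_1} ⋯ A_{i_k j_k}`. -/
theorem sigma_eq_kronecker_sum (n k : ℕ) (hk : k ≤ n)
    (A : Matrix (Fin n) (Fin n) ℝ) (hA : A.IsHermitian) :
    sigmaEig A hA k =
      (1 / (Nat.factorial k : ℝ)) *
        ∑ i : Fin k → Fin n, ∑ j : Fin k → Fin n,
          gKron i j * ∏ a : Fin k, A (i a) (j a) := by
  simp_rw [aux_sum_j]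
  rw [aux_sum_i, aux_sigma hk, one_div, inv_mul_cancel_left₀]
  exact_mod_cast k.factorial_ne_zero
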